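/- Let H' be the hybrid graph obtained from the closed blocked graph H by directing every edge with exactly one blocked end from its blocked end toward its unblocked end and making every other edge undirected. Then H' has no semidirected cycle (H' is a chain graph) and H' is triplex equivalent to G. -/

import Mathlib

/-- There is an edge between `a` and `b`: a directed edge `a → b`, a directed edge
`b → a`, or an undirected edge `a − b`. -/
def Adj (dir und : V → V → Prop) (a b : V) : Prop :=
  dir a b ∨ dir b a ∨ und a b ∨ und b a

/-- A hybrid graph: undirected edges are symmetric, there are no self loops, and there
is at most one edge between any pair of distinct nodes. -/
def IsHybrid (dir und : V → V → Prop) : Prop :=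
  (∀ a b, und a b → und b a) ∧
  (∀ a b, dir a b → a ≠ b) ∧
  (∀ a b, und a b → a ≠ b) ∧
  (∀ a b, dir a b → ¬ dir b a) ∧
  (∀ a b, dir a b → ¬ und a b ∧ ¬ und b a)

/-- Every pair of consecutive elements of the list `l` is related by `R`. -/
def ChainRel (R : V → V → Prop) (l : List V) : Prop :=
  ∀ (i : ℕ) (a b : V), l[i]? = some a → l[i + 1]? = some b → R a b

/-- The list `l` is a route in the graph, i.e. consecutive nodes are adjacent
(and `l` is nonempty). -/
def IsRoute (dir und : V → V → Prop) (l : List V) : Prop :=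
  l ≠ [] ∧ ChainRel (Adj dir und) l

/-- The list `l` is a descending route: every step is `a → b` or `a − b`. -/
def IsDescRouteList (dir und : V → V → Prop) (l : List V) : Prop :=
  l ≠ [] ∧ ChainRel (fun a b => dir a b ∨ und a b) l

/-- There is a descending route from `a` to `b`. -/
def DescRoute (dir und : V → V → Prop) (a b : V) : Prop :=
  ∃ l : List V, l.head? = some a ∧ l.getLast? = some b ∧
    ChainRel (fun x y => dir x y ∨ und x y) l

/-- The list `l` is a semidirected cycle. -/
def SemidirectedCycle (dir und : V → V → Prop) (l : List V) : Prop :=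
  2 ≤ l.length ∧ l.head? = l.getLast? ∧
  ChainRel (fun a b => dir a b ∨ und a b) l ∧
  ∃ (i : ℕ) (a b : V), l[i]? = some a ∧ l[i + 1]? = some b ∧ dir a b

/-- A chain graph is a hybrid graph with no semidirected cycle. -/
def IsChainGraph (dir und : V → V → Prop) : Prop :=
  IsHybrid dir und ∧ ∀ l : List V, ¬ SemidirectedCycle dir und l

/-- The parents of the set of nodes `X`. -/
def pa (dir : V → V → Prop) (X : Set V) : Set V :=
  {v | v ∉ X ∧ ∃ w ∈ X, dir v w}

/-- The neighbors of the set of nodes `X`. -/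
def nbr (und : V → V → Prop) (X : Set V) : Set V :=
  {v | v ∉ X ∧ ∃ w ∈ X, und v w}

/-- The adjacents of the set of nodes `X`. -/
def adSet (dir und : V → V → Prop) (X : Set V) : Set V :=
  {v | v ∉ X ∧ ∃ w ∈ X, Adj dir und v w}

/-- The descendants of the set of nodes `X`. -/
def de (dir und : V → V → Prop) (X : Set V) : Set V :=
  {v | v ∉ X ∧ ∃ w ∈ X, DescRoute dir und w v}

/-- The connectivity component of the node `a`: all nodes reachable from `a` by a
route whose edges are all undirected. -/
def co (und : V → V → Prop) (a : V) : Set V :=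
  {b | Relation.ReflTransGen und a b}

/-- `b` is a head-no-tail node in the subroute `a, b, c`, i.e. the subroute is of
the form `a → b ← c`, `a → b − c` or `a − b ← c`. -/
def HeadNoTail (dir und : V → V → Prop) (a b c : V) : Prop :=
  (dir a b ∧ dir c b) ∨ (dir a b ∧ und b c) ∨ (und a b ∧ dir c b)

/-- The route `l` is `Z`-open: every head-no-tail (occurrence of a) node is in `Z`
and every other (occurrence of a) node is not in `Z`. -/
def ZOpen (dir und : V → V → Prop) (Z : Set V) (l : List V) : Prop :=
  ChainRel (Adj dir und) l ∧
  (∀ (i : ℕ) (a b c : V), l[i]? = some a → l[i + 1]? = some b → l[i + 2]? = some c →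
    (HeadNoTail dir und a b c ↔ b ∈ Z)) ∧
  (∀ a, l.head? = some a → a ∉ Z) ∧
  (∀ a, l.getLast? = some a → a ∉ Z)

/-- `X` is separated from `Y` given `Z`: there is no `Z`-open route between a node
of `X` and a node of `Y`. -/
def Separ (dir und : V → V → Prop) (X Y Z : Set V) : Prop :=
  ¬ ∃ (l : List V) (x y : V), x ∈ X ∧ y ∈ Y ∧ l.head? = some x ∧ l.getLast? = some y ∧
      ZOpen dir und Z l

/-- The graph has a triplex `({A,C},B)`: an induced subgraph of the form `A → B ← C`,
`A → B − C` or `A − B ← C`. -/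
def Triplex (dir und : V → V → Prop) (A B C : V) : Prop :=
  A ≠ C ∧ ¬ Adj dir und A C ∧
  ((dir A B ∧ dir C B) ∨ (dir A B ∧ und B C) ∨ (und A B ∧ dir C B))

/-- The graph has an immorality `A → B ← C`. -/
def Immorality (dir und : V → V → Prop) (A B C : V) : Prop :=
  A ≠ C ∧ ¬ Adj dir und A C ∧ dir A B ∧ dir C B

/-- The graph has a flag `A → B − C`. -/
def FlagIn (dir und : V → V → Prop) (A B C : V) : Prop :=
  A ≠ C ∧ ¬ Adj dir und A C ∧ dir A B ∧ und B C

/-- The least set of blocks over the skeleton of the graph closed under the rules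
R1-R4. `Blocked dir und S a b` means that the `a`-end of the edge `a - b` is blocked.
`S A B` is the fixed separator found for the nonadjacent pair `{A, B}`. -/
inductive Blocked (dir und : V → V → Prop) (S : V → V → Set V) : V → V → Prop where
  /-- R1 blocks the `A`-end of the edge `A - B`. -/
  | R1a (A B C : V) : Adj dir und A B → Adj dir und B C → A ≠ C → ¬ Adj dir und A C →
      B ∉ S A C → Blocked dir und S A B
  /-- R1 blocks the `C`-end of the edge `B - C`. -/
  | R1b (A B C : V) : Adj dir und A B → Adj dir und B C → A ≠ C → ¬ Adj dir und A C →
      B ∉ S A C → Blocked dir und S C B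
  | R2 (A B C : V) : Blocked dir und S A B → Adj dir und B C → A ≠ C → ¬ Adj dir und A C →
      B ∈ S A C → Blocked dir und S B C
  | R3 (A B : V) (l : List V) : l.head? = some A → l.getLast? = some B → 2 ≤ l.length →
      (∀ (i : ℕ) (a b : V), l[i]? = some a → l[i + 1]? = some b → Adj dir und a b) →
      (∀ (i : ℕ) (a b : V), l[i]? = some a → l[i + 1]? = some b → Blocked dir und S a b) →
      Adj dir und A B → Blocked dir und S A B
  | R4 (A B C D : V) : Adj dir und A B → Adj dir und A C → Adj dir und A D →
      Adj dir und C B → Adj dir und D B → Blocked dir und S C B → Blocked dir und S D B →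
      C ≠ D → ¬ Adj dir und C D → A ∈ S C D → B ∉ S C D → Blocked dir und S A B

/-- The directed edges of the hybrid graph `H'` obtained from the closed blocked graph:
an edge whose `a`-end is blocked and whose `b`-end is unblocked is directed as `a → b`. -/
def blkDir (dir und : V → V → Prop) (S : V → V → Set V) (a b : V) : Prop :=
  Adj dir und a b ∧ Blocked dir und S a b ∧ ¬ Blocked dir und S b a

/-- The undirected edges of the hybrid graph `H'` obtained from the closed blocked graph:
an edge with both ends blocked or both ends unblocked is undirected. -/
def blkUnd (dir und : V → V → Prop) (S : V → V → Set V) (a b : V) : Prop :=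
  Adj dir und a b ∧ (Blocked dir und S a b ↔ Blocked dir und S b a)

section Routes

variable {V : Type*} {R : V → V → Prop}

theorem ChainRel.cons {a b : V} {l : List V} (hab : R a b) (hl : ChainRel R l)
    (hb : l.head? = some b) : ChainRel R (a :: l) := by
  rintro (_ | i) x y hx hy
  · rw [List.head?_eq_getElem?] at hb
    simp_all
  · exact hl i x y (by simpa using hx) (by simpa using hy)

/-- Positions of a chain are linked by the reflexive transitive closure. -/
theorem ChainRel.reflTransGen {l : List V} (hl : ChainRel R l) {i : ℕ} {a : V}
    (ha : l[i]? = some a) (k : ℕ) :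
    ∀ {b : V}, l[i + k]? = some b → Relation.ReflTransGen R a b := by
  induction k with
  | zero =>
    intro b hb
    obtain rfl : a = b := by simpa [ha] using hb
    exact .refl
  | succ k ih =>
    intro b hb
    have hlt : i + k < l.length := by
      have := (List.getElem?_eq_some_iff.1 hb).1
      omega
    exact (ih (List.getElem?_eq_getElem hlt)).tail
      (hl (i + k) _ _ (List.getElem?_eq_getElem hlt) hb)

theorem ChainRel.transGen {l : List V} (hl : ChainRel R l) (hlen : 2 ≤ l.length) {a b : V}
    (ha : l.head? = some a) (hb : l.getLast? = some b) : Relation.TransGen R a b := by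
  match l, hlen with
  | x :: y :: t, _ =>
    obtain rfl : x = a := by simpa using ha
    refine .head' (hl 0 x y rfl rfl) (hl.reflTransGen (i := 1) rfl t.length ?_)
    rw [List.getLast?_eq_getElem?] at hb
    simpa [Nat.add_comm] using hb

theorem Relation.TransGen.exists_chainRel {a b : V} (h : Relation.TransGen R a b) :
    ∃ l : List V, l.head? = some a ∧ l.getLast? = some b ∧ 2 ≤ l.length ∧ ChainRel R l := by
  induction h using Relation.TransGen.head_induction_on with
  | @single a h =>
    refine ⟨[a, b], rfl, rfl, le_rfl, ChainRel.cons h ?_ rfl⟩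
    rintro i x y - hy
    simp at hy
  | @head a c h _ ih =>
    obtain ⟨l, hc, hb, hlen, hl⟩ := ih
    refine ⟨a :: l, rfl, ?_, by simp; omega, hl.cons h hc⟩
    cases l with
    | nil => simp at hc
    | cons x t => simpa using hb

end Routes

section ChainGraphs

variable {V : Type*} {dir und : V → V → Prop}

theorem Adj.symm {a b : V} (h : Adj dir und a b) : Adj dir und b a := by
  unfold Adj at *
  tauto

theorem IsHybrid.adj_ne (hG : IsHybrid dir und) {a b : V} (h : Adj dir und a b) : a ≠ b := by
  obtain ⟨-, hd, hu, -, -⟩ := hG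
  rcases h with h | h | h | h
  exacts [hd _ _ h, (hd _ _ h).symm, hu _ _ h, (hu _ _ h).symm]

theorem IsChainGraph.not_reflTransGen (hG : IsChainGraph dir und) {a b : V} (hab : dir a b) :
    ¬ Relation.ReflTransGen (fun x y => dir x y ∨ und x y) b a := by
  intro h
  rw [Relation.reflTransGen_iff_eq_or_transGen] at h
  rcases h with rfl | h
  · exact hG.1.2.1 _ _ hab rfl
  · obtain ⟨l, hb, ha, hlen, hl⟩ := h.exists_chainRel
    refine hG.2 (a :: l) ⟨by simp; omega, ?_, hl.cons (Or.inl hab) hb, 0, a, b, rfl, ?_, hab⟩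
    · cases l with
      | nil => simp at hb
      | cons x t => simpa using ha.symm
    · simpa [List.head?_eq_getElem?] using hb

theorem isChainGraph_of_not_reflTransGen (hG : IsHybrid dir und)
    (h : ∀ a b, dir a b → ¬ Relation.ReflTransGen (fun x y => dir x y ∨ und x y) b a) :
    IsChainGraph dir und := by
  refine ⟨hG, ?_⟩
  rintro l ⟨hlen, hends, hl, i, a, b, ha, hb, hab⟩
  have hi := (List.getElem?_eq_some_iff.1 hb).1
  have hlast : l[l.length - 1]? = l[0]? := by
    rw [← List.getLast?_eq_getElem?, ← List.head?_eq_getElem?, hends]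
  obtain ⟨c, hc⟩ : ∃ c, l[0]? = some c := ⟨_, List.getElem?_eq_getElem (by omega)⟩
  refine h a b hab (.trans (b := c) (hl.reflTransGen hb (l.length - 1 - (i + 1)) ?_)
    (hl.reflTransGen hc i (by simpa using ha)))
  rw [← hc, ← hlast]
  congr 1
  omega

theorem headNoTail_iff_notMem_of_separ {A B C : V} {Z : Set V}
    (hZ : Z ⊆ ({A, C} : Set V)ᶜ) (hsep : Separ dir und {A} {C} Z)
    (hAB : Adj dir und A B) (hBC : Adj dir und B C) :
    HeadNoTail dir und A B C ↔ B ∉ Z := by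
  have hA : A ∉ Z := fun h => hZ h (by simp)
  have hC : C ∉ Z := fun h => hZ h (by simp)
  by_contra hne
  refine hsep ⟨[A, B, C], A, C, rfl, rfl, rfl, rfl, ?_, ?_, ?_, ?_⟩
  · refine ChainRel.cons hAB (ChainRel.cons hBC ?_ rfl) rfl
    rintro i x y - hy
    simp at hy
  · rintro (_ | i) a b c ha hb hc
    · simp only [List.getElem?_cons_zero, List.getElem?_cons_succ, Option.some.injEq,
        zero_add] at ha hb hc
      subst ha hb hc
      by_cases hB : B ∈ Z <;> simp_all
    · simp at hc
  · simpa using hA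
  · simpa using hC

end ChainGraphs

section Blocks

variable {V : Type*} {dir und : V → V → Prop} {S : V → V → Set V}

theorem Blocked.adj {a b : V} (h : Blocked dir und S a b) : Adj dir und a b := by
  cases h with
  | R1a _ _ C h => exact h
  | R1b A _ _ _ h => exact h.symm
  | R2 A _ _ _ h => exact h
  | R3 _ _ l _ _ _ _ _ h => exact h
  | R4 _ _ C D h => exact h

theorem Blocked.of_transGen {a b : V} (h : Relation.TransGen (Blocked dir und S) a b)
    (hab : Adj dir und a b) : Blocked dir und S a b := by
  obtain ⟨l, ha, hb, hlen, hl⟩ := h.exists_chainRel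
  exact .R3 a b l ha hb hlen (fun i x y hx hy => (hl i x y hx hy).adj) hl hab

/-- An edge neither of whose ends is blocked. -/
def FreeEdge (dir und : V → V → Prop) (S : V → V → Set V) (a b : V) : Prop :=
  Adj dir und a b ∧ ¬ Blocked dir und S a b ∧ ¬ Blocked dir und S b a

theorem FreeEdge.symm {a b : V} (h : FreeEdge dir und S a b) : FreeEdge dir und S b a :=
  ⟨h.1.symm, h.2.2, h.2.1⟩

theorem Blocked.ne_of_freeEdge {a b c : V} (h : Blocked dir und S a b)
    (hbc : FreeEdge dir und S b c) : a ≠ c := by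
  rintro rfl
  exact hbc.2.2 h

theorem Blocked.adj_of_freeEdge {a b c : V} (h : Blocked dir und S a b)
    (hbc : FreeEdge dir und S b c) : Adj dir und a c := by
  by_contra hac
  by_cases hb : b ∈ S a c
  · exact hbc.2.1 (.R2 a b c h hbc.1 (h.ne_of_freeEdge hbc) hac hb)
  · exact hbc.2.2 (.R1b a b c h.adj hbc.1 (h.ne_of_freeEdge hbc) hac hb)

theorem Blocked.not_blocked_of_freeEdge {a b c : V} (h : Blocked dir und S a b)
    (hbc : FreeEdge dir und S b c) : ¬ Blocked dir und S c a :=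
  fun hca => hbc.2.2 (.of_transGen (.tail (.single hca) h) hbc.1.symm)

theorem Blocked.of_freeEdge_of_notMem {a b c d : V}
    (hab : Adj dir und a b) (hbd : Adj dir und b d) (had : a ≠ d) (hnad : ¬ Adj dir und a d)
    (hb : b ∉ S a d) (hbc : FreeEdge dir und S b c) : Blocked dir und S a c := by
  have h : Blocked dir und S a b := .R1a a b d hab hbd had hnad hb
  have hd : Blocked dir und S d b := .R1b a b d hab hbd had hnad hb
  have hac := h.adj_of_freeEdge hbc
  have hdc := hd.adj_of_freeEdge hbc
  by_cases hc : c ∈ S a d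
  · exact absurd (.R4 c b a d hbc.1.symm hac.symm hdc.symm hab hbd.symm h hd had hnad hc hb)
      hbc.2.2
  · exact .R1a a c d hac hdc.symm had hnad hc

/-- A block propagates across a free edge. -/
theorem Blocked.of_freeEdge (hS : ∀ A B, S A B = S B A) {a b c : V}
    (h : Blocked dir und S a b) (hbc : FreeEdge dir und S b c) : Blocked dir und S a c := by
  induction h generalizing c with
  | R1a a b d hab hbd had hnad hb => exact .of_freeEdge_of_notMem hab hbd had hnad hb hbc
  | R1b d b a hdb hba hda hnda hb =>
    exact .of_freeEdge_of_notMem hba.symm hdb.symm hda.symm (fun h => hnda h.symm)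
      (hS d a ▸ hb) hbc
  | R2 d a b hda hab hdb hndb ha ih =>
    have h : Blocked dir und S a b := .R2 d a b hda hab hdb hndb ha
    by_contra hac
    exact hndb ((ih ⟨h.adj_of_freeEdge hbc, hac, h.not_blocked_of_freeEdge hbc⟩).adj_of_freeEdge
      hbc.symm)
  | R3 a b l ha hb hlen hadj hl hab ih =>
    have h : Blocked dir und S a b := .R3 a b l ha hb hlen hadj hl hab
    have hchain : ChainRel (fun x y => Blocked dir und S x y ∧
        ∀ {c}, FreeEdge dir und S y c → Blocked dir und S x c) l :=
      fun i x y hx hy => ⟨hl i x y hx hy, ih i x y hx hy⟩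
    obtain ⟨w, haw, -, hw⟩ := Relation.TransGen.tail'_iff.1 (hchain.transGen hlen ha hb)
    exact .of_transGen (.tail' (haw.lift id fun _ _ h => h.1) (hw hbc)) (h.adj_of_freeEdge hbc)
  | R4 a b d e hab had hae hdb heb hbd hbe hde hnde ha hb ihd ihe =>
    have h : Blocked dir und S a b :=
      .R4 a b d e hab had hae hdb heb hbd hbe hde hnde ha hb
    have hd := ihd hbc
    have he := ihe hbc
    by_cases hc : c ∈ S d e
    · have hce : Blocked dir und S c e := .R2 d c e hd he.adj.symm hde hnde hc
      exact absurd hce (hbe.not_blocked_of_freeEdge hbc)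
    · exact .R4 a c d e (h.adj_of_freeEdge hbc) had hae hd.adj he.adj hd he hde hnde ha hc

theorem blocked_or_freeEdge_of_blkDir_or_blkUnd {a b : V}
    (h : blkDir dir und S a b ∨ blkUnd dir und S a b) :
    Blocked dir und S a b ∨ FreeEdge dir und S a b := by
  unfold blkDir blkUnd at h
  unfold FreeEdge
  tauto

/-- Descending routes of the oriented graph extend routes of blocks. -/
theorem transGen_blocked_of_descending (hS : ∀ A B, S A B = S B A) {a b c : V}
    (hab : Relation.TransGen (Blocked dir und S) a b)
    (hbc : Relation.ReflTransGen (fun x y => blkDir dir und S x y ∨ blkUnd dir und S x y) b c) :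
    Relation.TransGen (Blocked dir und S) a c := by
  induction hbc with
  | refl => exact hab
  | tail _ hxy ih =>
    rcases blocked_or_freeEdge_of_blkDir_or_blkUnd hxy with h | h
    · exact ih.tail h
    · obtain ⟨w, haw, hw⟩ := Relation.TransGen.tail'_iff.1 ih
      exact .tail' haw (hw.of_freeEdge hS h)

theorem blkDir.not_reflTransGen (hG : IsHybrid dir und) (hS : ∀ A B, S A B = S B A) {a b : V}
    (hab : blkDir dir und S a b) :
    ¬ Relation.ReflTransGen (fun x y => blkDir dir und S x y ∨ blkUnd dir und S x y) b a := by
  intro h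
  induction h using Relation.ReflTransGen.head_induction_on with
  | refl => exact hG.adj_ne hab.1 rfl
  | head hbc hca ih =>
    rcases blocked_or_freeEdge_of_blkDir_or_blkUnd hbc with hbc | hbc
    · exact hab.2.2 (.of_transGen (transGen_blocked_of_descending hS (.single hbc) hca)
        hab.1.symm)
    · exact ih ⟨hab.2.1.adj_of_freeEdge hbc, hab.2.1.of_freeEdge hS hbc,
        hab.2.1.not_blocked_of_freeEdge hbc⟩

theorem isHybrid_blkDir_blkUnd (hG : IsHybrid dir und) :
    IsHybrid (blkDir dir und S) (blkUnd dir und S) := by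
  refine ⟨fun a b h => ⟨h.1.symm, h.2.symm⟩, fun a b h => hG.adj_ne h.1,
    fun a b h => hG.adj_ne h.1, fun a b h h' => h.2.2 h'.2.1, fun a b h => ⟨fun h' => ?_,
    fun h' => ?_⟩⟩
  · exact h.2.2 (h'.2.1 h.2.1)
  · exact h.2.2 (h'.2.2 h.2.1)

theorem adj_blkDir_blkUnd_iff {a b : V} :
    Adj (blkDir dir und S) (blkUnd dir und S) a b ↔ Adj dir und a b := by
  constructor
  · rintro (h | h | h | h)
    exacts [h.1, h.1.symm, h.1, h.1.symm]
  · intro h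
    have := h.symm
    unfold Adj blkDir blkUnd
    tauto

theorem Blocked.dir_or_und (hG : IsChainGraph dir und)
    (hT : ∀ A B C, A ≠ C → ¬ Adj dir und A C → Adj dir und A B → Adj dir und B C →
      (HeadNoTail dir und A B C ↔ B ∉ S A C)) {a b : V} (h : Blocked dir und S a b) :
    dir a b ∨ und a b := by
  have hsymm := hG.1.1
  induction h with
  | R1a a b c hab hbc hac hnac hb =>
    have := (hT a b c hac hnac hab hbc).2 hb
    unfold HeadNoTail at this
    tauto
  | R1b c b a hcb hba hca hnca hb =>
    have := (hT c b a hca hnca hcb hba).2 hb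
    have := hsymm b a
    unfold HeadNoTail at *
    tauto
  | R2 c a b hca hab hcb hncb ha ih =>
    have := hT c a b hcb hncb hca.adj hab
    have := hsymm b a
    unfold HeadNoTail Adj at *
    tauto
  | R3 a b l ha hb hlen hadj hl hab ih =>
    have hchain : ChainRel (fun x y => dir x y ∨ und x y) l := ih
    have := fun h : dir b a => hG.not_reflTransGen h (hchain.transGen hlen ha hb).to_reflTransGen
    have := hsymm b a
    unfold Adj at hab
    tauto
  | R4 a b c d hab hac had hcb hdb hbc hbd hcd hncd ha hb ihc ihd =>
    by_contra hcon
    have hba : dir b a := by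
      have := hsymm b a
      unfold Adj at hab
      tauto
    have key : ∀ x, Adj dir und a x → dir x b ∨ und x b → dir x a := by
      intro x hax hxb
      by_contra hxa
      have hax' : dir a x ∨ und a x := by
        have := hsymm x a
        unfold Adj at hax
        tauto
      exact hG.not_reflTransGen hba (.tail (.tail .refl hax') hxb)
    exact (hT c a d hcd hncd hac.symm had).1 (Or.inl ⟨key c hac ihc, key d had ihd⟩) ha

theorem triplex_blkDir_blkUnd_iff (hG : IsChainGraph dir und) (hS : ∀ A B, S A B = S B A)
    (hT : ∀ A B C, A ≠ C → ¬ Adj dir und A C → Adj dir und A B → Adj dir und B C →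
      (HeadNoTail dir und A B C ↔ B ∉ S A C)) (A B C : V) :
    Triplex (blkDir dir und S) (blkUnd dir und S) A B C ↔ Triplex dir und A B C := by
  unfold Triplex
  rw [adj_blkDir_blkUnd_iff]
  refine and_congr_right fun hne => and_congr_right fun hnadj => ?_
  constructor
  · intro h
    have hAB : Adj dir und A B := by
      rcases h with h | h | h <;> exact h.1.1
    have hBC : Adj dir und B C := by
      rcases h with h | h | h
      exacts [h.2.1.symm, h.2.1, h.2.1.symm]
    refine (hT A B C hne hnadj hAB hBC).2 fun hB => ?_
    have h1 : Blocked dir und S A B → Blocked dir und S B C :=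
      fun h => .R2 A B C h hBC hne hnadj hB
    have h2 : Blocked dir und S C B → Blocked dir und S B A :=
      fun h => .R2 C B A h hAB.symm hne.symm (fun h => hnadj h.symm) (hS A C ▸ hB)
    unfold blkDir blkUnd at h
    tauto
  · intro h
    have hAB : Adj dir und A B := by
      unfold Adj
      tauto
    have hBC : Adj dir und B C := by
      unfold Adj
      tauto
    have hB := (hT A B C hne hnadj hAB hBC).1 h
    have hA : Blocked dir und S A B := .R1a A B C hAB hBC hne hnadj hB
    have hC : Blocked dir und S C B := .R1b A B C hAB hBC hne hnadj hB
    have hCB := hBC.symm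
    have hnot : ¬ (Blocked dir und S B A ∧ Blocked dir und S B C) := by
      rintro ⟨h1, h2⟩
      have h1 := h1.dir_or_und hG hT
      have h2 := h2.dir_or_und hG hT
      obtain ⟨⟨hu, -, -, hd, hdu⟩, -⟩ := hG
      have := hd A B
      have := hd C B
      have := hdu A B
      have := hdu C B
      tauto
    by_cases hBA : Blocked dir und S B A
    · exact .inr (.inr ⟨⟨hAB, by tauto⟩, hCB, hC, by tauto⟩)
    · by_cases hBC' : Blocked dir und S B C
      · exact .inr (.inl ⟨⟨hAB, hA, hBA⟩, hBC, by tauto⟩)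
      · exact .inl ⟨⟨hAB, hA, hBA⟩, hCB, hC, hBC'⟩

end Blocks

theorem stmt_16 {V : Type} [Fintype V] (dir und : V → V → Prop)
    (hG : IsChainGraph dir und) (S : V → V → Set V)
    (hSsymm : ∀ A B : V, S A B = S B A)
    (hSsep : ∀ A B : V, A ≠ B → ¬ Adj dir und A B →
      S A B ⊆ ({A, B} : Set V)ᶜ ∧ Separ dir und {A} {B} (S A B)) :
    IsChainGraph (blkDir dir und S) (blkUnd dir und S) ∧
    (∀ a b : V, Adj (blkDir dir und S) (blkUnd dir und S) a b ↔ Adj dir und a b) ∧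
    (∀ A B C : V,
      Triplex (blkDir dir und S) (blkUnd dir und S) A B C ↔ Triplex dir und A B C) := by
  have hT : ∀ A B C, A ≠ C → ¬ Adj dir und A C → Adj dir und A B → Adj dir und B C →
      (HeadNoTail dir und A B C ↔ B ∉ S A C) := fun A B C hne hnadj hAB hBC =>
    headNoTail_iff_notMem_of_separ (hSsep A C hne hnadj).1 (hSsep A C hne hnadj).2 hAB hBC
  exact ⟨isChainGraph_of_not_reflTransGen (isHybrid_blkDir_blkUnd hG.1)
      fun a b hab => hab.not_reflTransGen hG.1 hSsymm,
    fun a b => adj_blkDir_blkUnd_iff, triplex_blkDir_blkUnd_iff hG hSsymm hT⟩
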